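/- (Miura transformation) Let w : ℝ × ℝ → ℝ be a smooth solution of the modified KdV equation ∂_t w = ∂_x³ w − (1/6) w² ∂_x w. Then the function u := ∂_x w − (1/6) w² is a solution of the KdV equation ∂_t u = u ∂_x u + ∂_x³ u at every point of ℝ². -/

import Mathlib

open Real

/-- Partial derivative in the first coordinate. -/
noncomputable def pdx (f : ℝ × ℝ → ℝ) (p : ℝ × ℝ) : ℝ := fderiv ℝ f p (1, 0)

/-- Partial derivative in the second coordinate. -/
noncomputable def pdy (f : ℝ × ℝ → ℝ) (p : ℝ × ℝ) : ℝ := fderiv ℝ f p (0, 1)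

theorem pdx_sub {f g : ℝ × ℝ → ℝ} (hf : Differentiable ℝ f) (hg : Differentiable ℝ g) :
    pdx (fun q => f q - g q) = fun q => pdx f q - pdx g q := by
  funext p
  simp [pdx, fderiv_fun_sub (hf p) (hg p)]

theorem pdx_mul {f g : ℝ × ℝ → ℝ} (hf : Differentiable ℝ f) (hg : Differentiable ℝ g) :
    pdx (fun q => f q * g q) = fun q => f q * pdx g q + pdx f q * g q := by
  funext p
  simp [pdx, fderiv_fun_mul (hf p) (hg p), mul_comm]

theorem pdx_add {f g : ℝ × ℝ → ℝ} (hf : Differentiable ℝ f) (hg : Differentiable ℝ g) :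
    pdx (fun q => f q + g q) = fun q => pdx f q + pdx g q := by
  funext p
  simp [pdx, fderiv_fun_add (hf p) (hg p)]

theorem pdx_const_mul (c : ℝ) {f : ℝ × ℝ → ℝ} (hf : Differentiable ℝ f) :
    pdx (fun q => c * f q) = fun q => c * pdx f q := by
  funext p
  simp [pdx, fderiv_const_mul (hf p)]

theorem pdx_sq {f : ℝ × ℝ → ℝ} (hf : Differentiable ℝ f) :
    pdx (fun q => f q ^ 2) = fun q => 2 * (f q * pdx f q) := by
  simp only [sq, pdx_mul hf hf]
  funext p
  ring

theorem pdy_sub_const_mul_sq (c : ℝ) {f g : ℝ × ℝ → ℝ} (hf : Differentiable ℝ f)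
    (hg : Differentiable ℝ g) (p : ℝ × ℝ) :
    pdy (fun q => f q - c * g q ^ 2) p = pdy f p - c * (2 * (g p * pdy g p)) := by
  have h := (hf p).hasFDerivAt.sub (((hg p).hasFDerivAt.pow 2).const_mul c)
  have h' : fderiv ℝ (fun q => f q - c * g q ^ 2) p = _ := h.fderiv
  simp [pdy, h', -mul_eq_mul_left_iff]
  ring

theorem contDiff_pdx {f : ℝ × ℝ → ℝ} (hf : ContDiff ℝ (⊤ : ℕ∞) f) :
    ContDiff ℝ (⊤ : ℕ∞) (pdx f) :=
  (hf.fderiv_right (m := (⊤ : ℕ∞)) le_rfl).clm_apply contDiff_const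

theorem pdy_pdx_comm {f : ℝ × ℝ → ℝ} (hf : ContDiff ℝ (⊤ : ℕ∞) f) (p : ℝ × ℝ) :
    pdy (pdx f) p = pdx (pdy f) p := by
  have hd : DifferentiableAt ℝ (fderiv ℝ f) p :=
    (hf.fderiv_right (m := (⊤ : ℕ∞)) le_rfl).differentiable (by simp) p
  have key (v u : ℝ × ℝ) :
      fderiv ℝ (fun q => fderiv ℝ f q v) p u = fderiv ℝ (fderiv ℝ f) p u v := by
    simp [fderiv_clm_apply hd (differentiableAt_const v)]
  have hs : IsSymmSndFDerivAt ℝ f p :=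
    hf.contDiffAt.isSymmSndFDerivAt
      (by
        rw [minSmoothness_of_isRCLikeNormedField]
        exact WithTop.coe_le_coe.2 (le_top : (2 : ℕ∞) ≤ ⊤))
  exact (key (1, 0) (0, 1)).trans ((hs _ _).trans (key (0, 1) (1, 0)).symm)

/-- Miura transformation: if `w` solves mKdV then `u = w_x - w²/6` solves KdV. -/
theorem miura_transformation
    (w : ℝ × ℝ → ℝ) (hw : ContDiff ℝ (⊤ : ℕ∞) w)
    (hmkdv : ∀ p : ℝ × ℝ,
      pdy w p = pdx (pdx (pdx w)) p - (1 / 6) * (w p) ^ 2 * pdx w p) :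
    ∀ p : ℝ × ℝ,
      pdy (fun q => pdx w q - (1 / 6) * (w q) ^ 2) p
        = (pdx w p - (1 / 6) * (w p) ^ 2) *
            pdx (fun q => pdx w q - (1 / 6) * (w q) ^ 2) p
          + pdx (pdx (pdx (fun q => pdx w q - (1 / 6) * (w q) ^ 2))) p := by
  intro p
  have hw1 := contDiff_pdx hw
  have hw2 := contDiff_pdx hw1
  have hw3 := contDiff_pdx hw2
  have d0 : Differentiable ℝ w := hw.differentiable (by simp)
  have d1 : Differentiable ℝ (pdx w) := hw1.differentiable (by simp)
  have d2 : Differentiable ℝ (pdx (pdx w)) := hw2.differentiable (by simp)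
  have d3 : Differentiable ℝ (pdx (pdx (pdx w))) := hw3.differentiable (by simp)
  have dsq : Differentiable ℝ (fun q => w q ^ 2) := d0.pow 2
  have hux : pdx (fun q => pdx w q - (1 / 6) * w q ^ 2)
      = fun q => pdx (pdx w) q - (1 / 6) * (2 * (w q * pdx w q)) := by
    rw [pdx_sub d1 (dsq.const_mul _), pdx_const_mul _ dsq, pdx_sq d0]
  have d01 : Differentiable ℝ (fun q => w q * pdx w q) := d0.mul d1
  have huxx : pdx (fun q => pdx (pdx w) q - (1 / 6) * (2 * (w q * pdx w q)))
      = fun q => pdx (pdx (pdx w)) q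
        - (1 / 6) * (2 * (w q * pdx (pdx w) q + pdx w q * pdx w q)) := by
    rw [pdx_sub d2 ((d01.const_mul _).const_mul _), pdx_const_mul _ (d01.const_mul _),
      pdx_const_mul _ d01, pdx_mul d0 d1]
  have d02 : Differentiable ℝ (fun q => w q * pdx (pdx w) q) := d0.mul d2
  have d11 : Differentiable ℝ (fun q => pdx w q * pdx w q) := d1.mul d1
  have ds : Differentiable ℝ (fun q => w q * pdx (pdx w) q + pdx w q * pdx w q) := d02.add d11
  have hwt : pdy w = fun q => pdx (pdx (pdx w)) q - (1 / 6) * (w q ^ 2 * pdx w q) := by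
    funext q
    rw [hmkdv q]
    ring
  have dsq1 : Differentiable ℝ (fun q => w q ^ 2 * pdx w q) := dsq.mul d1
  rw [pdy_sub_const_mul_sq _ d1 d0, pdy_pdx_comm hw, hux, huxx,
    pdx_sub d3 ((ds.const_mul _).const_mul _), pdx_const_mul _ (ds.const_mul _),
    pdx_const_mul _ ds, pdx_add d02 d11, pdx_mul d0 d2, pdx_mul d1 d1, hwt,
    pdx_sub d3 (dsq1.const_mul _), pdx_const_mul _ dsq1, pdx_mul dsq d1, pdx_sq d0]
  ring
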